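/- Let 1 ≤ k ≤ n−1. Then f : Λ^{k+1} × Λ^{k−1} → ℝ is ext-int. one affine if and only if there exist g : Λ^{k+1} → ℝ and h : Λ^{k−1} → ℝ with f(ξ,η) = g(ξ) + h(η) for all ξ ∈ Λ^{k+1}, η ∈ Λ^{k−1}, where: (i) g is affine and h is int. one affine, when n ≤ 2k−2; (ii) g and h are both affine, when n ∈ {2k−1, 2k, 2k+1} or both k and n are even; (iii) g is ext. one affine and h is affine, when n ≥ 2k+2. -/

import Mathlib

/-! Basic setup: `Λᵏ(ℝⁿ)` in coordinates with respect to the standard basis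
`e^I`, `I` a strictly increasing multi-index (modeled as a `k`-element subset of
`Fin n`), together with the exterior product, interior product, inner product,
Hodge star, and the various notions of one-directional convexity/affinity. -/

/-- Increasing multi-indices of length `k` in `{1,…,n}`: `k`-element subsets of `Fin n`.
`Idx n k` plays the role of `T_k`. -/
abbrev Idx (n k : ℕ) := {s : Finset (Fin n) // s.card = k}

/-- `Λᵏ(ℝⁿ)`, identified with its coordinates in the standard basis `e^I`. -/
abbrev Lam (n k : ℕ) := Idx n k → ℝ

/-- The sign `sgn(R,S)` defined by `e^{[R,S]} = sgn(R,S) e^R ∧ e^S` for disjoint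
increasing multi-indices: `(-1)` to the number of inversions between `R` and `S`. -/
def msign {n : ℕ} (R S : Finset (Fin n)) : ℝ :=
  (-1 : ℝ) ^ (((R ×ˢ S).filter (fun p => p.2 < p.1)).card)

/-- The basis form `e^S` (of degree `k = S.card`; zero if `k ≠ S.card`). -/
def bform {n k : ℕ} (S : Finset (Fin n)) : Lam n k :=
  fun I => if I.1 = S then 1 else 0

/-- Exterior (wedge) product in coordinates.  When `m = k + l` this is the wedge
product `Λᵏ × Λˡ → Λ^{k+l}`; for other `m` it is `0`. -/
def wedge {n k l m : ℕ} (ω : Lam n k) (φ : Lam n l) : Lam n m :=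
  fun I => ∑ R : Idx n k, ∑ S : Idx n l,
    if R.1 ∪ S.1 = I.1 ∧ Disjoint R.1 S.1 then msign R.1 S.1 * (ω R * φ S) else 0

/-- Interior product `a ⌟ b`, characterized by `⟨a ⌟ b; c⟩ = ⟨b; a ∧ c⟩`.  When
`m = k - j` this is the interior product `Λʲ × Λᵏ → Λ^{k-j}`; for other `m` it is `0`. -/
def iprod {n j k m : ℕ} (a : Lam n j) (b : Lam n k) : Lam n m :=
  fun C => ∑ A : Idx n j, ∑ B : Idx n k,
    if A.1 ∪ C.1 = B.1 ∧ Disjoint A.1 C.1 then msign A.1 C.1 * (a A * b B) else 0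

/-- Hodge star with respect to the standard orientation; when `m = n - k` this is
`∗ : Λᵏ → Λ^{n-k}`. -/
def hstar {n k m : ℕ} (ω : Lam n k) : Lam n m :=
  fun J => ∑ I : Idx n k, if I.1 = (J.1)ᶜ then msign I.1 J.1 * ω I else 0

/-- Inner product `⟨·;·⟩` on `Λᵏ` (the basis `e^I` is orthonormal). -/
def ip {n k : ℕ} (ω α : Lam n k) : ℝ := ∑ I : Idx n k, ω I * α I

/-- `s`-fold exterior power `ω^s = ω ∧ ⋯ ∧ ω` (with `ω^0 = 1 ∈ Λ⁰`). -/
def lpow {n k : ℕ} (ω : Lam n k) : (s : ℕ) → Lam n (k * s)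
  | 0 => bform ∅
  | s + 1 => wedge ω (lpow ω s)

/-- `f : Λᵏ → ℝ` is ext. one convex. -/
def ExtOneConvex {n k : ℕ} (f : Lam n k → ℝ) : Prop :=
  ∀ (ω : Lam n k) (a : Lam n 1) (b : Lam n (k-1)),
    ConvexOn ℝ Set.univ (fun t : ℝ => f (ω + t • (wedge a b : Lam n k)))

/-- `f : Λᵏ → ℝ` is ext. one affine. -/
def ExtOneAffine {n k : ℕ} (f : Lam n k → ℝ) : Prop :=
  ExtOneConvex f ∧ ExtOneConvex (fun ω => -f ω)

/-- `f : Λᵏ → ℝ` is int. one convex. -/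
def IntOneConvex {n k : ℕ} (f : Lam n k → ℝ) : Prop :=
  ∀ (ω : Lam n k) (a : Lam n 1) (b : Lam n (k+1)),
    ConvexOn ℝ Set.univ (fun t : ℝ => f (ω + t • (iprod a b : Lam n k)))

/-- `f : Λᵏ → ℝ` is int. one affine. -/
def IntOneAffine {n k : ℕ} (f : Lam n k → ℝ) : Prop :=
  IntOneConvex f ∧ IntOneConvex (fun ω => -f ω)

/-- `f : Λ^{k+1} × Λ^{k-1} → ℝ` is ext-int. one convex. -/
def ExtIntOneConvex {n k : ℕ} (f : Lam n (k+1) → Lam n (k-1) → ℝ) : Prop :=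
  ∀ (ξ : Lam n (k+1)) (η : Lam n (k-1)) (a : Lam n 1) (b : Lam n k),
    ConvexOn ℝ Set.univ
      (fun t : ℝ => f (ξ + t • (wedge a b : Lam n (k+1))) (η + t • (iprod a b : Lam n (k-1))))

/-- `f : Λ^{k+1} × Λ^{k-1} → ℝ` is ext-int. one affine. -/
def ExtIntOneAffine {n k : ℕ} (f : Lam n (k+1) → Lam n (k-1) → ℝ) : Prop :=
  ExtIntOneConvex f ∧ ExtIntOneConvex (fun ξ η => -f ξ η)

/-- `g : Λᵏ → ℝ` is affine, i.e. a constant plus a linear functional. -/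
def AffineFn {n k : ℕ} (g : Lam n k → ℝ) : Prop :=
  ∃ (c : ℝ) (a : Lam n k), ∀ ω, g ω = c + ip a ω

section SecondDifference

variable {E : Type*} [AddCommGroup E] {φ : E → ℝ}

/-- Second difference of `φ` at `x` in the directions `u`, `v`. -/
def secondDiff (φ : E → ℝ) (x u v : E) : ℝ := φ (x + u + v) - φ (x + u) - φ (x + v) + φ x

/-- All second differences of `φ` in the directions `u`, `v` vanish. -/
def Decoupled (φ : E → ℝ) (u v : E) : Prop := ∀ x, secondDiff φ x u v = 0

lemma secondDiff_comm (x u v : E) : secondDiff φ x u v = secondDiff φ x v u := by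
  simp only [secondDiff, add_right_comm x u v]; ring

lemma secondDiff_add_left (x u u' v : E) :
    secondDiff φ x (u + u') v = secondDiff φ (x + u') u v + secondDiff φ x u' v := by
  simp only [secondDiff, add_assoc, add_left_comm, add_comm]; ring

lemma secondDiff_add_base (x y u v : E) :
    secondDiff φ (x + y) u v =
      secondDiff φ x u v + secondDiff φ (x + v) u y - secondDiff φ x u y := by
  simp only [secondDiff, add_assoc, add_left_comm, add_comm]; ring

lemma Decoupled.symm {u v : E} (h : Decoupled φ u v) : Decoupled φ v u := fun x => by
  rw [secondDiff_comm]; exact h x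

lemma Decoupled.add_left {u u' v : E} (h : Decoupled φ u v) (h' : Decoupled φ u' v) :
    Decoupled φ (u + u') v := fun x => by
  rw [secondDiff_add_left, h, h', add_zero]

lemma Decoupled.zero_left (v : E) : Decoupled φ 0 v := fun x => by simp [secondDiff]

lemma Decoupled.sum_left {ι : Type*} {s : Finset ι} {u : ι → E} {v : E}
    (h : ∀ i ∈ s, Decoupled φ (u i) v) : Decoupled φ (∑ i ∈ s, u i) v :=
  Finset.sum_induction u (Decoupled φ · v) (fun _ _ => Decoupled.add_left)
    (Decoupled.zero_left v) h

lemma secondDiff_add_secondDiff_eq_zero {p q r s : E} (h : Decoupled φ (p + q) (s + r))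
    (hpq : Decoupled φ p q) (hps : Decoupled φ p s) (hqr : Decoupled φ q r) (x : E) :
    secondDiff φ x p r + secondDiff φ x q s = 0 := by
  have key := h x
  rw [secondDiff_add_left, secondDiff_comm _ p, secondDiff_comm _ q, secondDiff_add_left,
    secondDiff_add_left, secondDiff_comm _ s p, secondDiff_comm _ r p, secondDiff_comm _ s q,
    secondDiff_comm _ r q, hps, hqr, secondDiff_add_base x q p r, hpq, hpq,
    secondDiff_add_base x r q s, hqr, hqr] at key
  linarith

variable [Module ℝ E]

/-- `φ` is affine along every line of direction `u`. -/
def LineAffine (φ : E → ℝ) (u : E) : Prop :=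
  ∀ (x : E) (t : ℝ), φ (x + t • u) = φ x + t * (φ (x + u) - φ x)

lemma secondDiff_smul_left {u : E} (hu : LineAffine φ u) (x v : E) (t : ℝ) :
    secondDiff φ x (t • u) v = t * secondDiff φ x u v := by
  simp only [secondDiff, add_right_comm x _ v]
  rw [hu, hu]; ring

lemma secondDiff_smul_smul {u v : E} (hu : LineAffine φ u) (hv : LineAffine φ v) (x : E)
    (s t : ℝ) : secondDiff φ x (s • u) (t • v) = s * t * secondDiff φ x u v := by
  rw [secondDiff_smul_left hu, secondDiff_comm, secondDiff_smul_left hv, secondDiff_comm]; ring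

lemma Decoupled.smul_left {u v : E} (hu : LineAffine φ u) (h : Decoupled φ u v) (t : ℝ) :
    Decoupled φ (t • u) v := fun x => by
  rw [secondDiff_smul_left hu, h, mul_zero]

lemma Decoupled.smul_smul {u v : E} (hu : LineAffine φ u) (hv : LineAffine φ v)
    (h : Decoupled φ u v) (s t : ℝ) : Decoupled φ (s • u) (t • v) :=
  ((h.smul_left hu s).symm.smul_left hv t).symm

lemma LineAffine.zero : LineAffine φ (0 : E) := fun x t => by simp

/-- A function that is affine along the lines of a linear subspace is affine on its cosets. -/
lemma Decoupled.of_lineAffine_range {B : Type*} [AddCommGroup B] [Module ℝ B] (L : B →ₗ[ℝ] E)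
    (h : ∀ b, LineAffine φ (L b)) (b b' : B) : Decoupled φ (L b) (L b') := by
  intro x
  have h1 := h b x 2
  have h2 := h b' x 2
  have h3 := h (b' - b) (x + (2 : ℝ) • L b) 2
  have h4 := h (b' - b) (x + (2 : ℝ) • L b) 1
  have e1 : x + (2 : ℝ) • L b + (2 : ℝ) • L (b' - b) = x + (2 : ℝ) • L b' := by
    rw [map_sub]; module
  have e2 : x + (2 : ℝ) • L b + L (b' - b) = x + L b + L b' := by
    rw [map_sub]; module
  rw [e1, e2] at h3
  simp only [secondDiff]
  linarith

end SecondDifference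

section Exchange

variable {n : ℕ}

/-- The number of elements of `M` below `i`. -/
def rankIn (M : Finset (Fin n)) (i : Fin n) : ℕ := (M.filter (· < i)).card

lemma msign_singleton (i : Fin n) (S : Finset (Fin n)) :
    msign {i} S = (-1) ^ rankIn S i := by
  unfold msign rankIn
  congr 1
  rw [Finset.singleton_product, Finset.filter_map, Finset.card_map]
  rfl

lemma rankIn_union {S T : Finset (Fin n)} (h : Disjoint S T) (i : Fin n) :
    rankIn (S ∪ T) i = rankIn S i + rankIn T i := by
  unfold rankIn
  rw [Finset.filter_union, Finset.card_union_of_disjoint (Finset.disjoint_filter_filter h)]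

lemma rankIn_insert {S : Finset (Fin n)} {j : Fin n} (hj : j ∉ S) (i : Fin n) :
    rankIn (insert j S) i = rankIn S i + if j < i then 1 else 0 := by
  unfold rankIn
  rw [Finset.filter_insert]
  split_ifs
  · rw [Finset.card_insert_of_notMem (by simp [hj])]
  · rfl

lemma sum_rankIn (M : Finset (Fin n)) : ∑ i ∈ M, rankIn M i = ∑ i ∈ Finset.range M.card, i := by
  induction M using Finset.induction_on_max with
  | empty => simp
  | insert a s ha ih =>
    have has : a ∉ s := fun h => lt_irrefl _ (ha a h)
    rw [Finset.sum_insert has, Finset.card_insert_of_notMem has, Finset.sum_range_succ, ← ih,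
      add_comm]
    congr 1
    · refine Finset.sum_congr rfl fun i hi => ?_
      rw [rankIn_insert has, if_neg (ha i hi).not_gt, add_zero]
    · rw [rankIn_insert has, if_neg (lt_irrefl a), add_zero, rankIn,
        Finset.filter_true_of_mem ha]

variable {E : Type*} [AddCommGroup E] [Module ℝ E] {φ : E → ℝ} {e : Finset (Fin n) → E} {m : ℕ}

lemma secondDiff_exchange (he : ∀ I, LineAffine φ (e I))
    (h₁ : ∀ I J, ¬ Disjoint I J → Decoupled φ (e I) (e J)) (hm : 1 ≤ m)
    (h₂ : ∀ i j A B, i ≠ j → i ∉ A → j ∉ A → i ∉ B → j ∉ B → A.card = m → B.card = m →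
      Decoupled φ (msign {i} A • e (insert i A) + msign {j} A • e (insert j A))
        (msign {i} B • e (insert i B) + msign {j} B • e (insert j B)))
    {i j : Fin n} {A B : Finset (Fin n)} (hij : i ≠ j) (hiA : i ∉ A) (hjA : j ∉ A)
    (hiB : i ∉ B) (hjB : j ∉ B) (hA : A.card = m) (hB : B.card = m) (hAB : Disjoint A B) (x : E) :
    (-1) ^ rankIn (insert i A ∪ insert j B) i *
        secondDiff φ x (e (insert i A)) (e (insert j B)) =
      (-1) ^ rankIn (insert i A ∪ insert j B) j *
        secondDiff φ x (e (insert j A)) (e (insert i B)) := by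
  obtain ⟨a, ha⟩ : A.Nonempty := Finset.card_pos.1 (by omega)
  have meet {S T : Finset (Fin n)} {y : Fin n} (hS : y ∈ S) (hT : y ∈ T) (s t : ℝ) :
      Decoupled φ (s • e S) (t • e T) :=
    (h₁ S T (Finset.not_disjoint_iff.2 ⟨y, hS, hT⟩)).smul_smul (he S) (he T) s t
  have key := secondDiff_add_secondDiff_eq_zero (h₂ i j A B hij hiA hjA hiB hjB hA hB)
    (meet (Finset.mem_insert_of_mem ha) (Finset.mem_insert_of_mem ha) _ _)
    (meet (Finset.mem_insert_self i A) (Finset.mem_insert_self i B) _ _)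
    (meet (Finset.mem_insert_self j A) (Finset.mem_insert_self j B) _ _) x
  rw [secondDiff_smul_smul (he _) (he _), secondDiff_smul_smul (he _) (he _)] at key
  simp only [msign_singleton] at key
  have hdisj : Disjoint (insert i A) (insert j B) := by
    simp only [Finset.disjoint_insert_left, Finset.disjoint_insert_right, Finset.mem_insert]
    tauto
  rw [rankIn_union hdisj, rankIn_union hdisj, rankIn_insert hiA, rankIn_insert hjB,
    rankIn_insert hiA, rankIn_insert hjB]
  have sq (r : ℕ) : ((-1 : ℝ) ^ r) * (-1) ^ r = 1 := by rw [← mul_pow]; norm_num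
  generalize secondDiff φ x (e (insert i A)) (e (insert j B)) = D at *
  generalize secondDiff φ x (e (insert j A)) (e (insert i B)) = D' at *
  have s₁ := sq (rankIn B i)
  have s₂ := sq (rankIn B j)
  simp only [pow_add]
  generalize ((-1 : ℝ) ^ rankIn A i) = α at *
  generalize ((-1 : ℝ) ^ rankIn B i) = β at *
  generalize ((-1 : ℝ) ^ rankIn A j) = γ at *
  generalize ((-1 : ℝ) ^ rankIn B j) = δ at *
  rcases hij.lt_or_gt with h | h
  · simp only [h, h.not_gt, lt_irrefl, if_true, if_false, pow_zero, pow_one]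
    linear_combination β * δ * key - α * β * D * s₂ - γ * δ * D' * s₁
  · simp only [h, h.not_gt, lt_irrefl, if_true, if_false, pow_zero, pow_one]
    linear_combination - β * δ * key + α * β * D * s₂ + γ * δ * D' * s₁

lemma decoupled_of_even (he : ∀ I, LineAffine φ (e I))
    (h₁ : ∀ I J, ¬ Disjoint I J → Decoupled φ (e I) (e J)) (hm : 1 ≤ m) (hm' : Even m)
    (h₂ : ∀ i j A B, i ≠ j → i ∉ A → j ∉ A → i ∉ B → j ∉ B → A.card = m → B.card = m →
      Decoupled φ (msign {i} A • e (insert i A) + msign {j} A • e (insert j A))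
        (msign {i} B • e (insert i B) + msign {j} B • e (insert j B)))
    {I J : Finset (Fin n)} (hI : I.card = m + 1) (hJ : J.card = m + 1) :
    Decoupled φ (e I) (e J) := by
  by_cases hIJ : Disjoint I J
  swap
  · exact h₁ I J hIJ
  intro x
  set M := I ∪ J with hM
  have hMc : M.card = (m + 1) + (m + 1) := by rw [hM, Finset.card_union_of_disjoint hIJ, hI, hJ]
  let F : Finset (Fin n) → ℝ := fun S =>
    (-1) ^ (∑ i ∈ S, rankIn M i) * secondDiff φ x (e S) (e (M \ S))
  have const : ∀ d, ∀ S T : Finset (Fin n), S ⊆ M → T ⊆ M → S.card = m + 1 → T.card = m + 1 →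
      (S \ T).card = d → F S = F T := by
    intro d
    induction d with
    | zero =>
      intro S T _ _ hS hT hd
      rw [Finset.card_eq_zero, Finset.sdiff_eq_empty_iff_subset] at hd
      rw [Finset.eq_of_subset_of_card_le hd (by omega)]
    | succ d ih =>
      intro S T hSM hTM hS hT hd
      obtain ⟨i, hi⟩ : (S \ T).Nonempty := Finset.card_pos.1 (by omega)
      obtain ⟨j, hj⟩ : (T \ S).Nonempty := Finset.card_pos.1 (by
        have := Finset.card_sdiff_add_card_inter S T
        have := Finset.card_sdiff_add_card_inter T S
        rw [Finset.inter_comm] at this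
        omega)
      rw [Finset.mem_sdiff] at hi hj
      have hij : i ≠ j := fun h => hj.2 (h ▸ hi.1)
      have hjM : j ∈ M \ S := Finset.mem_sdiff.2 ⟨hTM hj.1, hj.2⟩
      have hMS : (M \ S).card = m + 1 := by rw [Finset.card_sdiff_of_subset hSM]; omega
      have hjA : j ∉ S.erase i := fun h => hj.2 (Finset.mem_of_mem_erase h)
      have hiA : i ∉ S.erase i := Finset.notMem_erase i S
      have key := secondDiff_exchange he h₁ hm h₂ (i := i) (j := j) (A := S.erase i)
        (B := (M \ S).erase j) hij hiA hjA (by simp [hi.1])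
        (Finset.notMem_erase _ _) (by rw [Finset.card_erase_of_mem hi.1, hS]; rfl)
        (by rw [Finset.card_erase_of_mem hjM, hMS]; rfl)
        (Finset.disjoint_of_subset_left (Finset.erase_subset _ _)
          (Finset.disjoint_of_subset_right (Finset.erase_subset _ _) Finset.disjoint_sdiff)) x
      rw [Finset.insert_erase hi.1, Finset.insert_erase hjM, Finset.union_sdiff_of_subset hSM] at key
      have step : F S = F (insert j (S.erase i)) := by
        have hset : M \ insert j (S.erase i) = insert i ((M \ S).erase j) := by
          ext y
          have := @hSM y
          simp only [Finset.mem_sdiff, Finset.mem_insert, Finset.mem_erase]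
          by_cases hyi : y = i
          · subst hyi; simp [hij, hSM hi.1]
          · tauto
        simp only [F]
        rw [hset, Finset.sum_insert hjA, ← Finset.add_sum_erase S _ hi.1, add_comm, pow_add,
          mul_assoc, key, ← mul_assoc, ← pow_add, add_comm]
      rw [step]
      refine ih _ T ?_ hTM ?_ hT ?_
      · exact Finset.insert_subset (hTM hj.1) ((Finset.erase_subset _ _).trans hSM)
      · rw [Finset.card_insert_of_notMem hjA, Finset.card_erase_of_mem hi.1]; omega
      · have : insert j (S.erase i) \ T = (S \ T).erase i := by
          ext y
          simp only [Finset.mem_sdiff, Finset.mem_insert, Finset.mem_erase]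
          by_cases hyj : y = j
          · subst hyj; simp [hj.1]
          · tauto
        rw [this, Finset.card_erase_of_mem (Finset.mem_sdiff.2 hi), hd]; rfl
  have key := const _ I J Finset.subset_union_left Finset.subset_union_right hI hJ rfl
  have hMI : M \ I = J := by rw [hM, Finset.union_sdiff_cancel_left hIJ]
  have hMJ : M \ J = I := by rw [hM, Finset.union_sdiff_cancel_right hIJ]
  simp only [F, hMI, hMJ] at key
  rw [secondDiff_comm x (e J)] at key
  have hodd : Odd (∑ i ∈ I, rankIn M i + ∑ i ∈ J, rankIn M i) := by
    rw [← Finset.sum_union hIJ, ← hM, sum_rankIn, hMc, Finset.sum_range_id]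
    obtain ⟨r, rfl⟩ := hm'
    have : (r + r + 1 + (r + r + 1)) * (r + r + 1 + (r + r + 1) - 1) / 2
        = (2 * r + 1) * (4 * r + 1) := by
      apply Nat.div_eq_of_eq_mul_left (by norm_num)
      have : r + r + 1 + (r + r + 1) - 1 = 4 * r + 1 := by omega
      rw [this]; ring
    rw [this]
    exact (odd_two_mul_add_one r).mul ⟨2 * r, by ring⟩
  have hprod := hodd.neg_one_pow (α := ℝ)
  rw [pow_add] at hprod
  have hsq : ((-1 : ℝ) ^ (∑ i ∈ J, rankIn M i)) * (-1) ^ (∑ i ∈ J, rankIn M i) = 1 := by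
    rw [← mul_pow]; norm_num
  linear_combination (-1 / 2 * (-1 : ℝ) ^ (∑ i ∈ J, rankIn M i)) * key +
    (1 / 2 * secondDiff φ x (e I) (e J)) * (hprod - hsq)

end Exchange

section Coordinates

variable {n k l m : ℕ}

lemma bform_eq_zero {S : Finset (Fin n)} (h : S.card ≠ k) : (bform S : Lam n k) = 0 := by
  ext I
  have : I.1 ≠ S := fun hI => h (hI ▸ I.2)
  simp [bform, this]

lemma sum_bform_smul (ω : Lam n k) : ∑ I : Idx n k, ω I • (bform I.1 : Lam n k) = ω := by
  ext J
  simp [bform, Finset.sum_apply, ← Subtype.ext_iff]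

lemma wedge_add_left (a a' : Lam n k) (b : Lam n l) :
    (wedge (a + a') b : Lam n m) = wedge a b + wedge a' b := by
  ext I
  simp only [wedge, Pi.add_apply, ← Finset.sum_add_distrib]
  refine Finset.sum_congr rfl fun R _ => Finset.sum_congr rfl fun S _ => ?_
  split_ifs <;> ring

lemma wedge_smul_left (t : ℝ) (a : Lam n k) (b : Lam n l) :
    (wedge (t • a) b : Lam n m) = t • wedge a b := by
  ext I
  simp only [wedge, Pi.smul_apply, smul_eq_mul, Finset.mul_sum]
  refine Finset.sum_congr rfl fun R _ => Finset.sum_congr rfl fun S _ => ?_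
  split_ifs <;> ring

lemma wedge_add_right (a : Lam n k) (b b' : Lam n l) :
    (wedge a (b + b') : Lam n m) = wedge a b + wedge a b' := by
  ext I
  simp only [wedge, Pi.add_apply, ← Finset.sum_add_distrib]
  refine Finset.sum_congr rfl fun R _ => Finset.sum_congr rfl fun S _ => ?_
  split_ifs <;> ring

lemma wedge_smul_right (t : ℝ) (a : Lam n k) (b : Lam n l) :
    (wedge a (t • b) : Lam n m) = t • wedge a b := by
  ext I
  simp only [wedge, Pi.smul_apply, smul_eq_mul, Finset.mul_sum]
  refine Finset.sum_congr rfl fun R _ => Finset.sum_congr rfl fun S _ => ?_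
  split_ifs <;> ring

lemma iprod_add_left (a a' : Lam n k) (b : Lam n l) :
    (iprod (a + a') b : Lam n m) = iprod a b + iprod a' b := by
  ext I
  simp only [iprod, Pi.add_apply, ← Finset.sum_add_distrib]
  refine Finset.sum_congr rfl fun R _ => Finset.sum_congr rfl fun S _ => ?_
  split_ifs <;> ring

lemma iprod_smul_left (t : ℝ) (a : Lam n k) (b : Lam n l) :
    (iprod (t • a) b : Lam n m) = t • iprod a b := by
  ext I
  simp only [iprod, Pi.smul_apply, smul_eq_mul, Finset.mul_sum]
  refine Finset.sum_congr rfl fun R _ => Finset.sum_congr rfl fun S _ => ?_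
  split_ifs <;> ring

lemma iprod_add_right (a : Lam n k) (b b' : Lam n l) :
    (iprod a (b + b') : Lam n m) = iprod a b + iprod a b' := by
  ext I
  simp only [iprod, Pi.add_apply, ← Finset.sum_add_distrib]
  refine Finset.sum_congr rfl fun R _ => Finset.sum_congr rfl fun S _ => ?_
  split_ifs <;> ring

lemma iprod_smul_right (t : ℝ) (a : Lam n k) (b : Lam n l) :
    (iprod a (t • b) : Lam n m) = t • iprod a b := by
  ext I
  simp only [iprod, Pi.smul_apply, smul_eq_mul, Finset.mul_sum]
  refine Finset.sum_congr rfl fun R _ => Finset.sum_congr rfl fun S _ => ?_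
  split_ifs <;> ring

lemma wedge_bform_bform {R S : Finset (Fin n)} (hR : R.card = k) (hS : S.card = l) :
    (wedge (bform R : Lam n k) (bform S : Lam n l) : Lam n m) =
      if Disjoint R S then msign R S • bform (R ∪ S) else 0 := by
  ext I
  rw [wedge, Finset.sum_eq_single ⟨R, hR⟩, Finset.sum_eq_single ⟨S, hS⟩]
  · by_cases h : Disjoint R S <;> simp [bform, h, eq_comm]
  · intro T _ hT
    have : T.1 ≠ S := fun h => hT (Subtype.ext h)
    simp [bform, this]
  · simp
  · intro T _ hT
    have : T.1 ≠ R := fun h => hT (Subtype.ext h)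
    simp [bform, this]
  · simp

lemma iprod_bform_bform {R S : Finset (Fin n)} (hR : R.card = k) (hS : S.card = l) :
    (iprod (bform R : Lam n k) (bform S : Lam n l) : Lam n m) =
      if R ⊆ S then msign R (S \ R) • bform (S \ R) else 0 := by
  ext I
  rw [iprod, Finset.sum_eq_single ⟨R, hR⟩, Finset.sum_eq_single ⟨S, hS⟩]
  · have key : R ∪ I.1 = S ∧ Disjoint R I.1 ↔ R ⊆ S ∧ I.1 = S \ R := by
      constructor
      · rintro ⟨rfl, h⟩
        exact ⟨Finset.subset_union_left, (Finset.union_sdiff_cancel_left h).symm⟩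
      · rintro ⟨h, hI⟩
        rw [hI]
        exact ⟨Finset.union_sdiff_of_subset h, Finset.disjoint_sdiff⟩
    simp only [key]
    by_cases h : R ⊆ S
    · by_cases hI : I.1 = S \ R <;> simp [bform, h, hI]
    · simp [h]
  · intro T _ hT
    have : T.1 ≠ S := fun h => hT (Subtype.ext h)
    simp [bform, this]
  · simp
  · intro T _ hT
    have : T.1 ≠ R := fun h => hT (Subtype.ext h)
    simp [bform, this]
  · simp

/-- The map `b ↦ (a ∧ b, a ⌟ b)`. -/
def extInt (a : Lam n 1) : Lam n k →ₗ[ℝ] Lam n (k + 1) × Lam n (k - 1) where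
  toFun b := (wedge a b, iprod a b)
  map_add' b b' := by rw [wedge_add_right, iprod_add_right]; rfl
  map_smul' t b := by rw [wedge_smul_right, iprod_smul_right]; rfl

lemma extInt_add (a a' : Lam n 1) (b : Lam n k) :
    extInt (a + a') b = extInt a b + extInt a' b :=
  Prod.ext (wedge_add_left a a' b) (iprod_add_left a a' b)

lemma extInt_smul (t : ℝ) (a : Lam n 1) (b : Lam n k) :
    extInt (t • a) b = t • extInt a b :=
  Prod.ext (wedge_smul_left t a b) (iprod_smul_left t a b)

lemma extInt_bform_of_notMem {i : Fin n} {S : Finset (Fin n)} (hS : S.card = k) (hi : i ∉ S) :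
    extInt (bform {i}) (bform S : Lam n k) = (msign {i} S • bform (insert i S), 0) := by
  refine Prod.ext ?_ ?_
  · refine (wedge_bform_bform (Finset.card_singleton i) hS).trans ?_
    simp [hi]
  · refine (iprod_bform_bform (Finset.card_singleton i) hS).trans ?_
    simp [hi]

lemma extInt_bform_of_mem {i : Fin n} {S : Finset (Fin n)} (hS : S.card = k) (hi : i ∈ S) :
    extInt (bform {i}) (bform S : Lam n k) = (0, msign {i} (S.erase i) • bform (S.erase i)) := by
  refine Prod.ext ?_ ?_
  · refine (wedge_bform_bform (Finset.card_singleton i) hS).trans ?_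
    simp [hi]
  · refine (iprod_bform_bform (Finset.card_singleton i) hS).trans ?_
    simp [hi, Finset.sdiff_singleton_eq_erase]

lemma msign_mul_self (R S : Finset (Fin n)) : msign R S * msign R S = 1 := by
  rw [msign, ← mul_pow]; norm_num

lemma exists_extInt_eq_left {i : Fin n} {I : Finset (Fin n)} (hI : I.card = k + 1) (hi : i ∈ I) :
    ∃ b : Lam n k, extInt (bform {i}) b = (bform I, 0) := by
  refine ⟨msign {i} (I.erase i) • bform (I.erase i), ?_⟩
  rw [map_smul, extInt_bform_of_notMem (by rw [Finset.card_erase_of_mem hi, hI]; rfl)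
    (Finset.notMem_erase i I), Finset.insert_erase hi]
  simp [smul_smul, msign_mul_self]

lemma exists_extInt_eq_right {i : Fin n} {J : Finset (Fin n)} (hk : 1 ≤ k)
    (hJ : J.card = k - 1) (hi : i ∉ J) :
    ∃ b : Lam n k, extInt (bform {i}) b = (0, bform J) := by
  refine ⟨msign {i} J • bform (insert i J), ?_⟩
  rw [map_smul, extInt_bform_of_mem (by rw [Finset.card_insert_of_notMem hi, hJ]; omega)
    (Finset.mem_insert_self i J), Finset.erase_insert hi]
  simp [smul_smul, msign_mul_self]

lemma affineFn_of_decoupled {g : Lam n k → ℝ} (h : ∀ I, LineAffine g (bform I))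
    (h' : ∀ I J : Finset (Fin n), I.card = k → J.card = k →
      Decoupled g (bform I) (bform J)) : AffineFn g := by
  refine ⟨g 0, fun I => g (bform I.1) - g 0, fun ω => ?_⟩
  have key (s : Finset (Idx n k)) : g (∑ I ∈ s, ω I • (bform I.1 : Lam n k)) =
      g 0 + ∑ I ∈ s, (g (bform I.1) - g 0) * ω I := by
    induction s using Finset.induction_on with
    | empty => simp
    | insert J s hJ ih =>
      rw [Finset.sum_insert hJ, Finset.sum_insert hJ]
      have hd : Decoupled g (∑ I ∈ s, ω I • (bform I.1 : Lam n k)) (ω J • bform J.1) :=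
        Decoupled.sum_left fun I _ => (h' I.1 J.1 I.2 J.2).smul_smul (h _) (h _) _ _
      have h0 := hd 0
      have hl := h J.1 0 (ω J)
      simp only [secondDiff, zero_add] at h0 hl
      rw [add_comm (ω J • _)]
      linarith
  have := key Finset.univ
  rwa [sum_bform_smul] at this

end Coordinates

section OneAffine

variable {n k : ℕ}

lemma convexOn_and_convexOn_neg_iff {φ : ℝ → ℝ} :
    (ConvexOn ℝ Set.univ φ ∧ ConvexOn ℝ Set.univ fun t => -φ t) ↔
      ∀ t, φ t = φ 0 + t * (φ 1 - φ 0) := by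
  constructor
  · rintro ⟨h, h'⟩ t
    have seg (x y a b : ℝ) (ha : 0 ≤ a) (hb : 0 ≤ b) (hab : a + b = 1) :
        φ (a * x + b * y) = a * φ x + b * φ y := by
      have h1 := h.2 (Set.mem_univ x) (Set.mem_univ y) ha hb hab
      have h2 := h'.2 (Set.mem_univ x) (Set.mem_univ y) ha hb hab
      simp only [smul_eq_mul] at h1 h2
      linarith
    rcases le_total t 0 with ht | ht
    · have hpos : 0 < 1 - t := by linarith
      have key := seg t 1 (1 / (1 - t)) (-t / (1 - t)) (by positivity)
        (div_nonneg (by linarith) hpos.le) (by field_simp; ring)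
      have h0 : 1 / (1 - t) * t + -t / (1 - t) * 1 = 0 := by field_simp; ring
      rw [h0] at key
      field_simp at key
      linarith
    · rcases le_total t 1 with ht' | ht'
      · have key := seg 0 1 (1 - t) t (by linarith) ht (by ring)
        rw [show (1 - t) * 0 + t * 1 = t by ring] at key
        rw [key]; ring
      · have hpos : 0 < t := by linarith
        have key := seg 0 t (1 - 1 / t) (1 / t)
          (sub_nonneg.2 ((div_le_one hpos).2 ht')) (by positivity) (by ring)
        have h1 : (1 - 1 / t) * 0 + 1 / t * t = 1 := by field_simp; ring
        rw [h1] at key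
        field_simp at key
        linarith
  · intro h
    refine ⟨⟨convex_univ, ?_⟩, ⟨convex_univ, ?_⟩⟩ <;>
    · intro x _ y _ a b _ _ hab
      simp only [smul_eq_mul]
      rw [h (a * x + b * y), h x, h y]
      obtain rfl : a = 1 - b := by linarith
      apply le_of_eq
      ring

lemma lineAffine_iff_convexOn {E : Type*} [AddCommGroup E] [Module ℝ E] {φ : E → ℝ} {u : E} :
    LineAffine φ u ↔ ∀ x, ConvexOn ℝ Set.univ (fun t : ℝ => φ (x + t • u)) ∧
      ConvexOn ℝ Set.univ (fun t : ℝ => -φ (x + t • u)) := by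
  simp only [convexOn_and_convexOn_neg_iff, zero_smul, add_zero, one_smul]
  rfl

lemma extOneAffine_iff {g : Lam n k → ℝ} : ExtOneAffine g ↔
    ∀ (a : Lam n 1) (b : Lam n (k - 1)), LineAffine g (wedge a b) := by
  simp only [lineAffine_iff_convexOn]
  exact ⟨fun h a b x => ⟨h.1 x a b, h.2 x a b⟩,
    fun h => ⟨fun x a b => (h a b x).1, fun x a b => (h a b x).2⟩⟩

lemma intOneAffine_iff {g : Lam n k → ℝ} : IntOneAffine g ↔
    ∀ (a : Lam n 1) (b : Lam n (k + 1)), LineAffine g (iprod a b) := by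
  simp only [lineAffine_iff_convexOn]
  exact ⟨fun h a b x => ⟨h.1 x a b, h.2 x a b⟩,
    fun h => ⟨fun x a b => (h a b x).1, fun x a b => (h a b x).2⟩⟩

lemma extIntOneAffine_iff {f : Lam n (k + 1) → Lam n (k - 1) → ℝ} : ExtIntOneAffine f ↔
    ∀ (a : Lam n 1) (b : Lam n k), LineAffine (Function.uncurry f) (extInt a b) := by
  simp only [lineAffine_iff_convexOn]
  exact ⟨fun h a b x => ⟨h.1 x.1 x.2 a b, h.2 x.1 x.2 a b⟩,
    fun h => ⟨fun x y a b => (h a b (x, y)).1, fun x y a b => (h a b (x, y)).2⟩⟩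

lemma ip_add_smul (c ω u : Lam n k) (t : ℝ) : ip c (ω + t • u) = ip c ω + t * ip c u := by
  simp only [ip, Finset.mul_sum, ← Finset.sum_add_distrib, Pi.add_apply, Pi.smul_apply,
    smul_eq_mul]
  exact Finset.sum_congr rfl fun _ _ => by ring

lemma AffineFn.lineAffine {g : Lam n k → ℝ} (h : AffineFn g) (u : Lam n k) : LineAffine g u := by
  obtain ⟨c, α, hg⟩ := h
  intro x t
  have h1 := ip_add_smul α x u 1
  rw [one_smul] at h1
  rw [hg, hg, hg, ip_add_smul, h1]; ring

section Product

variable {F : Lam n (k + 1) × Lam n (k - 1) → ℝ}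
  (hF : ∀ (a : Lam n 1) (b : Lam n k), LineAffine F (extInt a b))

include hF

lemma lineAffine_left (I : Finset (Fin n)) : LineAffine F (bform I, 0) := by
  by_cases hI : I.card = k + 1
  · obtain ⟨i, hi⟩ : I.Nonempty := Finset.card_pos.1 (by omega)
    obtain ⟨b, hb⟩ := exists_extInt_eq_left hI hi
    exact hb ▸ hF _ b
  · rw [bform_eq_zero hI]; exact LineAffine.zero

lemma lineAffine_right (hk : 1 ≤ k) (hkn : k ≤ n) (J : Finset (Fin n)) :
    LineAffine F (0, bform J) := by
  by_cases hJ : J.card = k - 1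
  · obtain ⟨i, hi⟩ : Jᶜ.Nonempty := Finset.card_pos.1 (by
      rw [Finset.card_compl, Fintype.card_fin]; omega)
    obtain ⟨b, hb⟩ := exists_extInt_eq_right hk hJ (Finset.mem_compl.1 hi)
    exact hb ▸ hF _ b
  · rw [bform_eq_zero hJ]; exact LineAffine.zero

lemma decoupled_left {I J : Finset (Fin n)} (h : ¬ Disjoint I J) :
    Decoupled F (bform I, 0) (bform J, 0) := by
  obtain ⟨i, hi, hj⟩ := Finset.not_disjoint_iff.1 h
  by_cases hI : I.card = k + 1
  swap
  · rw [bform_eq_zero hI]; exact Decoupled.zero_left _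
  by_cases hJ : J.card = k + 1
  swap
  · rw [bform_eq_zero hJ]; exact (Decoupled.zero_left _).symm
  obtain ⟨b, hb⟩ := exists_extInt_eq_left hI hi
  obtain ⟨b', hb'⟩ := exists_extInt_eq_left hJ hj
  exact hb ▸ hb' ▸ Decoupled.of_lineAffine_range _ (hF _) b b'

lemma decoupled_right (hk : 1 ≤ k) {I J : Finset (Fin n)} (h : ¬ Disjoint Iᶜ Jᶜ) :
    Decoupled F (0, bform I) (0, bform J) := by
  obtain ⟨i, hi, hj⟩ := Finset.not_disjoint_iff.1 h
  rw [Finset.mem_compl] at hi hj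
  by_cases hI : I.card = k - 1
  swap
  · rw [bform_eq_zero hI]; exact Decoupled.zero_left _
  by_cases hJ : J.card = k - 1
  swap
  · rw [bform_eq_zero hJ]; exact (Decoupled.zero_left _).symm
  obtain ⟨b, hb⟩ := exists_extInt_eq_right hk hI hi
  obtain ⟨b', hb'⟩ := exists_extInt_eq_right hk hJ hj
  exact hb ▸ hb' ▸ Decoupled.of_lineAffine_range _ (hF _) b b'

lemma decoupled_left_right_bform (hk : 1 ≤ k) {I J : Finset (Fin n)} (hI : I.card = k + 1)
    (hJ : J.card = k - 1) : Decoupled F (bform I, 0) (0, bform J) := by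
  obtain ⟨i, hi, hj⟩ := Finset.exists_mem_notMem_of_card_lt_card (s := J) (t := I) (by omega)
  obtain ⟨b, hb⟩ := exists_extInt_eq_left hI hi
  obtain ⟨b', hb'⟩ := exists_extInt_eq_right hk hJ hj
  exact hb ▸ hb' ▸ Decoupled.of_lineAffine_range _ (hF _) b b'

lemma decoupled_left_right (hk : 1 ≤ k) (hkn : k ≤ n) (ξ : Lam n (k + 1)) (η : Lam n (k - 1)) :
    Decoupled F (ξ, 0) (0, η) := by
  have h₁ : (ξ, (0 : Lam n (k - 1))) = ∑ I : Idx n (k + 1), ξ I • (bform I.1, 0) := by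
    refine Prod.ext ?_ ?_
    · simp [Prod.fst_sum, sum_bform_smul]
    · simp [Prod.snd_sum]
  have h₂ : ((0 : Lam n (k + 1)), η) = ∑ J : Idx n (k - 1), η J • (0, bform J.1) := by
    refine Prod.ext ?_ ?_
    · simp [Prod.fst_sum]
    · simp [Prod.snd_sum, sum_bform_smul]
  rw [h₁, h₂]
  refine Decoupled.sum_left fun I _ => (Decoupled.sum_left fun J _ => Decoupled.symm ?_).symm
  exact (decoupled_left_right_bform hF hk I.2 J.2).smul_smul (lineAffine_left hF _)
    (lineAffine_right hF hk hkn _) _ _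

lemma decoupled_left_of_even (hk : 1 ≤ k) (hk' : Even k) {I J : Finset (Fin n)}
    (hI : I.card = k + 1) (hJ : J.card = k + 1) : Decoupled F (bform I, 0) (bform J, 0) := by
  refine decoupled_of_even (e := fun S => (bform S, 0)) (lineAffine_left hF)
    (fun _ _ => decoupled_left hF) hk hk' ?_ hI hJ
  intro i j A B _ hiA hjA hiB hjB hA hB
  have key := Decoupled.of_lineAffine_range (φ := F) (extInt (bform {i} + bform {j})) (hF _)
    (bform A) (bform B)
  rw [extInt_add, extInt_add, extInt_bform_of_notMem hA hiA, extInt_bform_of_notMem hA hjA,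
    extInt_bform_of_notMem hB hiB, extInt_bform_of_notMem hB hjB] at key
  simpa using key

lemma decoupled_right_of_even (hk : 1 ≤ k) (hkn : k ≤ n - 1) (hn : Even (n - k))
    {I J : Finset (Fin n)} (hI : I.card = k - 1) (hJ : J.card = k - 1) :
    Decoupled F (0, bform I) (0, bform J) := by
  have hcard {S : Finset (Fin n)} (hS : S.card = k - 1) : Sᶜ.card = n - k + 1 := by
    rw [Finset.card_compl, Fintype.card_fin]; omega
  have key := decoupled_of_even (φ := F) (e := fun S => (0, bform Sᶜ)) (m := n - k)
    (fun S => lineAffine_right hF hk (by omega) _)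
    (fun S T h => decoupled_right hF hk (by rwa [compl_compl, compl_compl])) (by omega) hn ?_
    (hcard hI) (hcard hJ)
  · simpa using key
  intro i j A B hij hiA hjA hiB hjB hA hB
  have hsign {i : Fin n} {A : Finset (Fin n)} (hi : i ∉ A) :
      msign {i} Finset.univ * msign {i} (Aᶜ.erase i) = msign {i} A := by
    have h1 : rankIn Finset.univ i = rankIn A i + rankIn (Aᶜ.erase i) i := by
      rw [← Finset.union_compl A, rankIn_union disjoint_compl_right,
        ← Finset.insert_erase (Finset.mem_compl.2 hi),
        rankIn_insert (Finset.notMem_erase i _), if_neg (lt_irrefl i), add_zero,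
        Finset.erase_insert (Finset.notMem_erase i _)]
    simp only [msign_singleton, h1]
    rw [pow_add, mul_assoc, ← mul_pow]
    norm_num
  have hcomp {A : Finset (Fin n)} (hA : A.card = n - k) : Aᶜ.card = k := by
    rw [Finset.card_compl, Fintype.card_fin]; omega
  have key := Decoupled.of_lineAffine_range (φ := F)
    (extInt (msign {i} Finset.univ • bform {i} + msign {j} Finset.univ • bform {j})) (hF _)
    (bform Aᶜ) (bform Bᶜ)
  simp only [extInt_add, extInt_smul] at key
  rw [extInt_bform_of_mem (hcomp hA) (Finset.mem_compl.2 hiA),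
    extInt_bform_of_mem (hcomp hA) (Finset.mem_compl.2 hjA),
    extInt_bform_of_mem (hcomp hB) (Finset.mem_compl.2 hiB),
    extInt_bform_of_mem (hcomp hB) (Finset.mem_compl.2 hjB)] at key
  simpa [smul_smul, hsign, hiA, hjA, hiB, hjB, Finset.compl_insert] using key

lemma affineFn_left (hk : 1 ≤ k) (h : n < 2 * k + 2 ∨ Even k) :
    AffineFn fun ξ => F (ξ, 0) := by
  refine affineFn_of_decoupled (fun I x t => ?_) fun I J hI hJ x => ?_
  · simpa using lineAffine_left hF I (x, 0) t
  have key : Decoupled F (bform I, 0) (bform J, 0) := by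
    rcases h with h | h
    · refine decoupled_left hF fun hd => ?_
      have := Finset.card_le_univ (I ∪ J)
      rw [Finset.card_union_of_disjoint hd, Fintype.card_fin] at this
      omega
    · exact decoupled_left_of_even hF hk h hI hJ
  simpa [secondDiff] using key (x, 0)

lemma affineFn_right (hk : 1 ≤ k) (hkn : k ≤ n - 1)
    (h : 2 * k - 2 < n ∨ (Even k ∧ Even n)) : AffineFn fun η => F (0, η) := by
  refine affineFn_of_decoupled (fun I x t => ?_) fun I J hI hJ x => ?_
  · simpa using lineAffine_right hF hk (by omega) I (0, x) t
  have key : Decoupled F (0, bform I) (0, bform J) := by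
    rcases h with h | h
    · refine decoupled_right hF hk fun hd => ?_
      have := Finset.card_le_univ (Iᶜ ∪ Jᶜ)
      rw [Finset.card_union_of_disjoint hd, Finset.card_compl, Finset.card_compl,
        Fintype.card_fin] at this
      omega
    · exact decoupled_right_of_even hF hk hkn (h.2.tsub h.1) hI hJ
  simpa [secondDiff] using key (0, x)

end Product

lemma AffineFn.sub_const {g : Lam n k → ℝ} (h : AffineFn g) (r : ℝ) :
    AffineFn fun ω => g ω - r := by
  obtain ⟨c, α, hg⟩ := h
  exact ⟨c - r, α, fun ω => by simp only [hg]; ring⟩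

end OneAffine

/-- **Corollary.** Let `1 ≤ k ≤ n-1`.  Then `f : Λ^{k+1} × Λ^{k-1} → ℝ` is
ext-int. one affine iff there exist `g : Λ^{k+1} → ℝ` and `h : Λ^{k-1} → ℝ` with
`f(ξ,η) = g(ξ) + h(η)`, where (i) `g` is affine and `h` is int. one affine when
`n ≤ 2k-2`; (ii) `g`, `h` are affine when `n ∈ {2k-1, 2k, 2k+1}` or both `k`, `n`
are even; (iii) `g` is ext. one affine and `h` is affine when `n ≥ 2k+2`. -/
theorem stmt6 {n k : ℕ} (hk : 1 ≤ k) (hkn : k ≤ n - 1)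
    (f : Lam n (k+1) → Lam n (k-1) → ℝ) :
    ExtIntOneAffine f ↔
      ∃ (g : Lam n (k+1) → ℝ) (h : Lam n (k-1) → ℝ),
        (∀ ξ η, f ξ η = g ξ + h η) ∧
        (n ≤ 2*k - 2 → AffineFn g ∧ IntOneAffine h) ∧
        ((n = 2*k - 1 ∨ n = 2*k ∨ n = 2*k + 1 ∨ (Even k ∧ Even n)) → AffineFn g ∧ AffineFn h) ∧
        (2*k + 2 ≤ n → ExtOneAffine g ∧ AffineFn h) := by
  rw [extIntOneAffine_iff]
  constructor
  · intro hF
    have split (ξ η) : f ξ η = f ξ 0 + (f 0 η - f 0 0) := by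
      have := decoupled_left_right hF hk (by omega) ξ η 0
      simp only [secondDiff, zero_add, Prod.mk_add_mk, add_zero, Function.uncurry_apply_pair,
        Prod.zero_eq_mk] at this
      linarith
    have hg (h : n < 2 * k + 2 ∨ Even k) : AffineFn fun ξ => f ξ 0 :=
      affineFn_left hF hk h
    have hh (h : 2 * k - 2 < n ∨ (Even k ∧ Even n)) : AffineFn fun η => f 0 η - f 0 0 :=
      (affineFn_right hF hk hkn h).sub_const _
    refine ⟨fun ξ => f ξ 0, fun η => f 0 η - f 0 0, split, fun h => ?_, fun h => ?_, fun h => ?_⟩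
    · have hA := hg (by omega)
      refine ⟨hA, ?_⟩
      obtain ⟨k, rfl⟩ : ∃ l, k = l + 1 := ⟨k - 1, by omega⟩
      refine intOneAffine_iff.2 fun a b η t => ?_
      have h₁ := hF a b (0, η) t
      have h₂ := hA.lineAffine (wedge a b) 0 t
      simp only [extInt, LinearMap.coe_mk, AddHom.coe_mk, Prod.smul_mk, Prod.mk_add_mk,
        Function.uncurry_apply_pair, split (0 + _) (η + _)] at h₁
      linarith
    · exact ⟨hg (by grind), hh (by grind)⟩
    · have hA := hh (by omega)
      refine ⟨extOneAffine_iff.2 fun a b ξ t => ?_, hA⟩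
      have h₁ := hF a b (ξ, 0) t
      have h₂ := hA.lineAffine (iprod a b) 0 t
      simp only [extInt, LinearMap.coe_mk, AddHom.coe_mk, Prod.smul_mk, Prod.mk_add_mk,
        Function.uncurry_apply_pair, split (ξ + _) (0 + _)] at h₁
      linarith
  · rintro ⟨g, h, hf, h₁, h₂, h₃⟩ a b
    have hg : LineAffine g (wedge a b) := by
      rcases le_or_gt (2 * k + 2) n with hn | hn
      · exact extOneAffine_iff.1 (h₃ hn).1 a b
      · rcases le_or_gt n (2 * k - 2) with hn' | hn'
        · exact (h₁ hn').1.lineAffine _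
        · exact (h₂ (by omega)).1.lineAffine _
    have hh : LineAffine h (iprod a b) := by
      rcases le_or_gt n (2 * k - 2) with hn' | hn'
      · obtain ⟨k, rfl⟩ : ∃ l, k = l + 1 := ⟨k - 1, by omega⟩
        exact intOneAffine_iff.1 (h₁ hn').2 a b
      · rcases le_or_gt (2 * k + 2) n with hn | hn
        · exact (h₃ hn).2.lineAffine _
        · exact (h₂ (by omega)).2.lineAffine _
    rintro ⟨ξ, η⟩ t
    have e₁ := hg ξ t
    have e₂ := hh η t
    simp only [extInt, LinearMap.coe_mk, AddHom.coe_mk, Prod.smul_mk, Prod.mk_add_mk,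
      Function.uncurry_apply_pair, hf]
    linarith
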